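/- arXiv:1112.4310 — 2 statements merged into one kernel-verified Lean document; each statement's English description precedes it below -/
import Mathlib

section
/- Let N ≥ 3 and let S = I_{11} ∪ ⋯ ∪ I_{NN}. Suppose x ≠ y lie in the same fiber F_t of A_S and put z = x − y. If some block I_{kl} contains two cells (i,j), (i′,j′) with z_{ij} > 0 and z_{i′j′} < 0, then ‖z‖_1 can be reduced by moves of Type I belonging to M_S. -/
open Finset

namespace Paper

abbrev Table (R C : ℕ) := Fin R × Fin C → ℤ

/-- The table with entry 1 in cell `a` and 0 elsewhere. -/
def e {R C : ℕ} (a : Fin R × Fin C) : Table R C := fun p => if p = a then 1 else 0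

/-- The l1-norm of an integer table. -/
def l1 {R C : ℕ} (z : Table R C) : ℤ := ∑ p : Fin R × Fin C, |z p|

/-- The configuration `A_{S_1,…,S_N}` : row sums, column sums and subtable sums. -/
def configMap {R C N : ℕ} (S : Fin N → Finset (Fin R × Fin C)) (z : Table R C) :
    (Fin R → ℤ) × (Fin C → ℤ) × (Fin N → ℤ) :=
  ⟨fun i => ∑ j, z (i, j), fun j => ∑ i, z (i, j), fun n => ∑ p ∈ S n, z p⟩

/-- A move for `A_{S_1,…,S_N}` : an integer table with vanishing row sums,
column sums and subtable sums. -/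
def IsMove {R C N : ℕ} (S : Fin N → Finset (Fin R × Fin C)) (z : Table R C) : Prop :=
  configMap S z = 0

/-- The fiber `F_t` of the configuration `A_{S_1,…,S_N}` : nonnegative integer tables
with prescribed row sums, column sums and subtable sums. -/
def Fiber {R C N : ℕ} (S : Fin N → Finset (Fin R × Fin C))
    (t : (Fin R → ℤ) × (Fin C → ℤ) × (Fin N → ℤ)) : Set (Table R C) :=
  {x | (∀ p, 0 ≤ x p) ∧ configMap S x = t}

/-- `B` is a Markov basis for the configuration `A_{S_1,…,S_N}`. -/
def IsMarkovBasis {R C N : ℕ} (S : Fin N → Finset (Fin R × Fin C))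
    (B : Set (Table R C)) : Prop :=
  B.Finite ∧ (∀ z ∈ B, IsMove S z) ∧ (∀ z ∈ B, -z ∈ B) ∧
    ∀ t, ∀ x ∈ Fiber S t, ∀ y ∈ Fiber S t, x ≠ y →
      ∃ U : ℕ, 0 < U ∧ ∃ zs : Fin U → Table R C,
        (∀ u, zs u ∈ B) ∧ y = x + ∑ u, zs u ∧
        ∀ u : Fin U, (x + ∑ s ∈ Finset.Iic u, zs s) ∈ Fiber S t

/-- `‖x − y‖₁` can be reduced by the set of moves `B` within the fiber `F`. -/
def CanReduce {R C : ℕ} (F : Set (Table R C)) (B : Set (Table R C))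
    (x y : Table R C) : Prop :=
  ∃ τp τm : ℕ, 0 < τp + τm ∧
    ∃ (Bp : Fin τp → Table R C) (Bm : Fin τm → Table R C),
      (∀ s, Bp s ∈ B) ∧ (∀ s, Bm s ∈ B) ∧
      (∀ u : Fin τp, (x + ∑ s ∈ Finset.Iic u, Bp s) ∈ F) ∧
      (∀ u : Fin τm, (y - ∑ s ∈ Finset.Iic u, Bm s) ∈ F) ∧
      l1 (x - y + ∑ s, Bp s + ∑ s, Bm s) < l1 (x - y)

/-- Basic moves (moves of Type I). -/
def IsBasicMove {R C : ℕ} (z : Table R C) : Prop :=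
  ∃ (i i' : Fin R) (j j' : Fin C), i ≠ i' ∧ j ≠ j' ∧
    z = e (i, j) + e (i', j') - e (i', j) - e (i, j')

/-- A rectangle in the set of cells. -/
def IsRectangle {R C : ℕ} (S : Finset (Fin R × Fin C)) : Prop :=
  ∃ (a₁ a₂ : Fin R) (b₁ b₂ : Fin C), a₁ < a₂ ∧ b₁ < b₂ ∧
    S = Finset.univ.filter fun p => a₁ ≤ p.1 ∧ p.1 ≤ a₂ ∧ b₁ ≤ p.2 ∧ p.2 ≤ b₂

/-- The positive part `z⁺` of a move. -/
def posPart {R C : ℕ} (z : Table R C) : Table R C := fun p => max (z p) 0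

/-- The negative part `z⁻` of a move. -/
def negPart {R C : ℕ} (z : Table R C) : Table R C := fun p => max (-z p) 0

/-- The `(k,l)` block `I_{kl}` (cells are 1-indexed in the paper, hence the `+ 1`). -/
def block {R C : ℕ} (rr cc : ℕ → ℕ) (k l : ℕ) : Finset (Fin R × Fin C) :=
  Finset.univ.filter fun p =>
    rr k ≤ p.1.1 + 1 ∧ p.1.1 + 1 < rr (k+1) ∧ cc l ≤ p.2.1 + 1 ∧ p.2.1 + 1 < cc (l+1)

/-- `S = I_{11} ∪ I_{22} ∪ ⋯ ∪ I_{NN}` : the union of the diagonal blocks. -/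
def Sdiag {R C : ℕ} (N : ℕ) (rr cc : ℕ → ℕ) : Finset (Fin R × Fin C) :=
  (Finset.Icc 1 N).biUnion fun k => block rr cc k k

/-- Two cells lie in a common block `I_{kl}` with `1 ≤ k,l ≤ Nb`. -/
def SameBlock {R C : ℕ} (Nb : ℕ) (rr cc : ℕ → ℕ) (p q : Fin R × Fin C) : Prop :=
  ∃ k l, 1 ≤ k ∧ k ≤ Nb ∧ 1 ≤ l ∧ l ≤ Nb ∧
    p ∈ block (R := R) (C := C) rr cc k l ∧ q ∈ block rr cc k l

/-- Two row indices lie in a common row block `[r_k, r_{k+1})`. -/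
def SameRowBlock {R : ℕ} (Nb : ℕ) (rr : ℕ → ℕ) (i i' : Fin R) : Prop :=
  ∃ k, 1 ≤ k ∧ k ≤ Nb ∧ rr k ≤ i.1 + 1 ∧ i.1 + 1 < rr (k+1) ∧
    rr k ≤ i'.1 + 1 ∧ i'.1 + 1 < rr (k+1)

/-- Moves of Type II: a degree-3 square-free move whose six nonzero cells
lie outside `S` and in six pairwise distinct blocks.  `Nd` bounds the index of the
diagonal blocks of `S`, `Nb` bounds the block indices. -/
def IsTypeII {R C : ℕ} (Nd Nb : ℕ) (rr cc : ℕ → ℕ) (z : Table R C) : Prop :=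
  ∃ (i₁ i₂ i₃ : Fin R) (j₁ j₂ j₃ : Fin C),
    z = e (i₁,j₂) + e (i₂,j₃) + e (i₃,j₁) - e (i₁,j₃) - e (i₂,j₁) - e (i₃,j₂) ∧
    (∀ p ∈ ([(i₁,j₂),(i₂,j₃),(i₃,j₁),(i₁,j₃),(i₂,j₁),(i₃,j₂)] : List (Fin R × Fin C)),
      p ∉ Sdiag Nd rr cc) ∧
    List.Pairwise (fun p q => ¬ SameBlock Nb rr cc p q)
      [(i₁,j₂),(i₂,j₃),(i₃,j₁),(i₁,j₃),(i₂,j₁),(i₃,j₂)]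

/-- Moves of Type III. -/
def IsTypeIII {R C : ℕ} (Nd Nb : ℕ) (rr cc : ℕ → ℕ) (z : Table R C) : Prop :=
  ∃ (i₁ i₂ i₃ : Fin R) (j₁ j₂ j₃ : Fin C),
    z = e (i₁,j₁) + e (i₂,j₃) + e (i₃,j₂) - e (i₁,j₃) - e (i₂,j₂) - e (i₃,j₁) ∧
    (∃ k l, 1 ≤ k ∧ k ≤ Nd ∧ 1 ≤ l ∧ l ≤ Nd ∧ k ≠ l ∧
      (i₁,j₁) ∈ block (R := R) (C := C) rr cc k k ∧ (i₂,j₂) ∈ block rr cc l l) ∧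
    (∀ p ∈ ([(i₂,j₃),(i₃,j₂),(i₁,j₃),(i₃,j₁)] : List (Fin R × Fin C)),
      p ∉ Sdiag Nd rr cc) ∧
    List.Pairwise (fun p q => ¬ SameBlock Nb rr cc p q) [(i₂,j₃),(i₃,j₂),(i₁,j₃),(i₃,j₁)]

/-- Moves of Type IV (row version). -/
def IsTypeIVrow {R C : ℕ} (Nd Nb : ℕ) (rr cc : ℕ → ℕ) (z : Table R C) : Prop :=
  ∃ (i₁ i₂ i₃ i₄ : Fin R) (j₁ j₂ j₃ j₄ : Fin C),
    z = e (i₁,j₁) + e (i₂,j₂) + e (i₃,j₃) + e (i₄,j₄)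
        - e (i₁,j₃) - e (i₂,j₄) - e (i₃,j₂) - e (i₄,j₁) ∧
    (∃ k l, 1 ≤ k ∧ k ≤ Nd ∧ 1 ≤ l ∧ l ≤ Nd ∧ k ≠ l ∧
      (i₁,j₁) ∈ block (R := R) (C := C) rr cc k k ∧ (i₃,j₂) ∈ block rr cc l l) ∧
    (∀ p ∈ ([(i₂,j₂),(i₃,j₃),(i₄,j₄),(i₁,j₃),(i₂,j₄),(i₄,j₁)] : List (Fin R × Fin C)),
      p ∉ Sdiag Nd rr cc) ∧
    SameRowBlock Nb rr i₁ i₂ ∧ SameRowBlock Nb rr i₃ i₄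

/-- Moves of Type IV, including the transposes of the row-version moves. -/
def IsTypeIV {R C : ℕ} (Nd Nb : ℕ) (rr cc : ℕ → ℕ) (z : Table R C) : Prop :=
  IsTypeIVrow Nd Nb rr cc z ∨
    IsTypeIVrow (R := C) (C := R) Nd Nb cc rr (fun p => z (p.2, p.1))

/-- The basic move. -/
def mv {R C : ℕ} (i i' : Fin R) (j j' : Fin C) : Table R C :=
  e (i, j) + e (i', j') - e (i', j) - e (i, j')

lemma blk_unique (N : ℕ) (rr : ℕ → ℕ) (hmono : ∀ n, 1 ≤ n → n ≤ N → rr n < rr (n + 1))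
    (m k n : ℕ) (hm : 1 ≤ m) (hmN : m ≤ N) (hk : 1 ≤ k) (hkN : k ≤ N)
    (h1 : rr m ≤ n) (h2 : n < rr (m+1)) (h3 : rr k ≤ n) (h4 : n < rr (k+1)) : m = k := by
  have key : ∀ d a, 1 ≤ a → a + d ≤ N + 1 → rr a ≤ rr (a + d) := by
    intro d
    induction d with
    | zero => intro a _ _; simp
    | succ d ih =>
      intro a ha had
      have := ih a ha (by omega)
      have h' := hmono (a + d) (by omega) (by omega)
      rw [← add_assoc]; omega
  rcases lt_trichotomy m k with h | h | h
  · have := key (k - (m+1)) (m+1) (by omega) (by omega)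
    rw [show m + 1 + (k - (m+1)) = k by omega] at this
    omega
  · exact h
  · have := key (m - (k+1)) (k+1) (by omega) (by omega)
    rw [show k + 1 + (m - (k+1)) = m by omega] at this
    omega

lemma sum_e {R C : ℕ} (T : Finset (Fin R × Fin C)) (a : Fin R × Fin C) :
    ∑ p ∈ T, e a p = if a ∈ T then 1 else 0 := by
  simp [e]

lemma mv_isMove {R C : ℕ} (T : Finset (Fin R × Fin C)) (i i' : Fin R) (j j' : Fin C)
    (h : (((i, j) ∈ T ↔ (i', j) ∈ T) ∧ ((i, j') ∈ T ↔ (i', j') ∈ T)) ∨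
      (((i, j) ∈ T ↔ (i, j') ∈ T) ∧ ((i', j) ∈ T ↔ (i', j') ∈ T))) :
    IsMove (fun _ : Fin 1 => T) (mv i i' j j') := by
  unfold IsMove configMap
  refine Prod.ext ?_ (Prod.ext ?_ ?_)
  · funext a
    simp only [mv, Pi.add_apply, Pi.sub_apply, sum_add_distrib, sum_sub_distrib]
    simp [e, Prod.ext_iff, ite_and]
  · funext b
    simp only [mv, Pi.add_apply, Pi.sub_apply, sum_add_distrib, sum_sub_distrib]
    have hcol : ∀ (a : Fin R) (c : Fin C), ∑ i, e (a, c) (i, b) = if b = c then 1 else 0 := by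
      intro a c
      by_cases hb : b = c <;> simp [e, hb]
    simp only [hcol]
    show _ = (0 : ℤ)
    ring
  · funext n
    simp only [mv, Pi.add_apply, Pi.sub_apply, sum_add_distrib, sum_sub_distrib, sum_e]
    show _ = (0 : ℤ)
    rcases h with ⟨h1, h2⟩ | ⟨h1, h2⟩
    · simp only [h1, h2]; ring
    · simp only [h1, h2]; ring

lemma configMap_add {R C n : ℕ} (S : Fin n → Finset (Fin R × Fin C)) (x z : Table R C) :
    configMap S (x + z) = configMap S x + configMap S z := by
  unfold configMap
  refine Prod.ext ?_ (Prod.ext ?_ ?_) <;> funext a <;> simp [sum_add_distrib]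

lemma configMap_sub {R C n : ℕ} (S : Fin n → Finset (Fin R × Fin C)) (x z : Table R C) :
    configMap S (x - z) = configMap S x - configMap S z := by
  unfold configMap
  refine Prod.ext ?_ (Prod.ext ?_ ?_) <;> funext a <;> simp [sum_sub_distrib]

lemma add_nonneg_mv {R C : ℕ} (x : Table R C) (hx : ∀ p, 0 ≤ x p)
    (i i' : Fin R) (j j' : Fin C) (hi : i ≠ i')
    (h1 : 0 < x (i', j)) (h2 : 0 < x (i, j')) (p : Fin R × Fin C) :
    0 ≤ (x + mv i i' j j') p := by
  have := hx p
  simp only [mv, e, Pi.add_apply, Pi.sub_apply]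
  by_cases hp1 : p = (i', j)
  · subst hp1
    have : ¬ (i', j) = (i, j') := by simp [Ne.symm hi]
    simp only [this, if_false, if_true]
    split_ifs <;> omega
  · by_cases hp2 : p = (i, j')
    · subst hp2
      simp only [hp1, if_false, if_true]
      split_ifs <;> omega
    · simp only [hp1, hp2, if_false]
      split_ifs <;> omega

lemma sub_nonneg_mv {R C : ℕ} (x : Table R C) (hx : ∀ p, 0 ≤ x p)
    (i i' : Fin R) (j j' : Fin C) (hi : i ≠ i')
    (h1 : 0 < x (i, j)) (h2 : 0 < x (i', j')) (p : Fin R × Fin C) :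
    0 ≤ (x - mv i i' j j') p := by
  have h := add_nonneg_mv x hx i' i j j' hi.symm h1 h2 p
  have : x - mv i i' j j' = x + mv i' i j j' := by
    simp only [mv]; abel
  rw [this]; exact h

lemma l1_mv {R C : ℕ} (z : Table R C) (i i' : Fin R) (j j' : Fin C) (hi : i ≠ i') (hj : j ≠ j')
    (s1 s2 s3 s4 : ℤ)
    (h1 : |z (i, j) + 1| ≤ |z (i, j)| + s1) (h2 : |z (i', j') + 1| ≤ |z (i', j')| + s2)
    (h3 : |z (i', j) - 1| ≤ |z (i', j)| + s3) (h4 : |z (i, j') - 1| ≤ |z (i, j')| + s4) :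
    l1 (z + mv i i' j j') ≤ l1 z + (s1 + s2 + s3 + s4) := by
  have hs : ∀ a : Fin R × Fin C, ∑ p, e a p = 1 := by intro a; simp [e]
  have : l1 z + (s1 + s2 + s3 + s4) =
      ∑ p, (|z p| + (s1 * e (i, j) p + s2 * e (i', j') p + s3 * e (i', j) p + s4 * e (i, j') p)) := by
    simp only [sum_add_distrib, ← mul_sum, hs, l1]; ring
  rw [this]
  unfold l1
  apply sum_le_sum
  intro p _
  by_cases p1 : p = (i, j)
  · subst p1; simpa [mv, e, hi, hj, hi.symm, hj.symm] using h1
  by_cases p2 : p = (i', j')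
  · subst p2; simpa [mv, e, hi, hj, hi.symm, hj.symm] using h2
  by_cases p3 : p = (i', j)
  · subst p3; simpa [mv, e, hi, hj, hi.symm, hj.symm, sub_eq_add_neg] using h3
  by_cases p4 : p = (i, j')
  · subst p4; simpa [mv, e, hi, hj, hi.symm, hj.symm, sub_eq_add_neg] using h4
  simp [mv, e, p1, p2, p3, p4]

lemma abs_up_le (a : ℤ) : |a + 1| ≤ |a| + 1 := by
  have := abs_add_le a 1; simpa using this
lemma abs_dn_le (a : ℤ) : |a - 1| ≤ |a| + 1 := by
  have := abs_add_le a (-1); simpa [sub_eq_add_neg] using this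
lemma abs_up_neg (a : ℤ) (h : a < 0) : |a + 1| ≤ |a| + (-1) := by
  rw [abs_of_neg h, abs_of_nonpos (by omega)]; omega
lemma abs_dn_pos (a : ℤ) (h : 0 < a) : |a - 1| ≤ |a| + (-1) := by
  rw [abs_of_pos h, abs_of_nonneg (by omega)]; omega

lemma exists_neg {ι : Type*} [Fintype ι] (f : ι → ℤ) (h : ∑ i, f i = 0) (i : ι) (hi : 0 < f i) :
    ∃ a, f a < 0 := by
  by_contra hc
  push Not at hc
  have := (sum_eq_zero_iff_of_nonneg (fun a _ => hc a)).1 h i (mem_univ i)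
  omega

lemma exists_pos' {ι : Type*} [Fintype ι] (f : ι → ℤ) (h : ∑ i, f i = 0) (i : ι) (hi : f i < 0) :
    ∃ a, 0 < f a := by
  obtain ⟨a, ha⟩ := exists_neg (fun i => - f i) (by simp [h]) i (by simpa using hi)
  exact ⟨a, by simpa using ha⟩

section core
variable {R C : ℕ}

/-- Type I moves in `M_T`. -/
def mvs (T : Finset (Fin R × Fin C)) : Set (Table R C) :=
  {z | IsBasicMove z ∧ IsMove (fun _ : Fin 1 => T) z}

lemma row_zero (T : Finset (Fin R × Fin C)) (t) (x y : Table R C)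
    (hx : x ∈ Fiber (fun _ : Fin 1 => T) t) (hy : y ∈ Fiber (fun _ : Fin 1 => T) t) (i : Fin R) :
    ∑ j, (x - y) (i, j) = 0 := by
  have h := configMap_sub (fun _ : Fin 1 => T) x y
  rw [hx.2, hy.2, sub_self] at h
  exact congrFun (congrArg Prod.fst h) i

lemma col_zero (T : Finset (Fin R × Fin C)) (t) (x y : Table R C)
    (hx : x ∈ Fiber (fun _ : Fin 1 => T) t) (hy : y ∈ Fiber (fun _ : Fin 1 => T) t) (j : Fin C) :
    ∑ i, (x - y) (i, j) = 0 := by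
  have h := configMap_sub (fun _ : Fin 1 => T) x y
  rw [hx.2, hy.2, sub_self] at h
  exact congrFun (congrArg (fun q => q.2.1) h) j

/-- Same row. -/
lemma same_row (T : Finset (Fin R × Fin C)) (t) (x y : Table R C)
    (hx : x ∈ Fiber (fun _ : Fin 1 => T) t) (hy : y ∈ Fiber (fun _ : Fin 1 => T) t)
    (i : Fin R) (j j' : Fin C) (hT : ∀ a, (a, j) ∈ T ↔ (a, j') ∈ T)
    (hp : 0 < (x - y) (i, j)) (hn : (x - y) (i, j') < 0) :
    ∃ D ∈ mvs T, y - D ∈ Fiber (fun _ : Fin 1 => T) t ∧ l1 (x - y + D) < l1 (x - y) := by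
  obtain ⟨a, ha⟩ := exists_neg _ (col_zero T t x y hx hy j) i hp
  have hai : a ≠ i := by rintro rfl; omega
  have hjj : j ≠ j' := by rintro rfl; omega
  have hm : IsMove (fun _ : Fin 1 => T) (mv a i j j') :=
    mv_isMove T a i j j' (Or.inr ⟨hT a, hT i⟩)
  refine ⟨mv a i j j', ⟨⟨a, i, j, j', hai, hjj, rfl⟩, hm⟩, ⟨?_, ?_⟩, ?_⟩
  · have h1 := hx.1 (a, j)
    have h2 := hx.1 (i, j')
    simp only [Pi.sub_apply] at ha hn
    exact sub_nonneg_mv y hy.1 a i j j' hai (by omega) (by omega)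
  · rw [configMap_sub, hm, hy.2, sub_zero]
  · have := l1_mv (x - y) a i j j' hai hjj (-1) (-1) (-1) 1 (abs_up_neg _ ha) (abs_up_neg _ hn)
      (abs_dn_pos _ hp) (abs_dn_le _)
    omega

/-- Same column. -/
lemma same_col (T : Finset (Fin R × Fin C)) (t) (x y : Table R C)
    (hx : x ∈ Fiber (fun _ : Fin 1 => T) t) (hy : y ∈ Fiber (fun _ : Fin 1 => T) t)
    (i i' : Fin R) (j : Fin C) (hT : ∀ b, (i, b) ∈ T ↔ (i', b) ∈ T)
    (hp : 0 < (x - y) (i, j)) (hn : (x - y) (i', j) < 0) :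
    ∃ D ∈ mvs T, y - D ∈ Fiber (fun _ : Fin 1 => T) t ∧ l1 (x - y + D) < l1 (x - y) := by
  obtain ⟨b, hb⟩ := exists_neg _ (row_zero T t x y hx hy i) j hp
  have hbj : b ≠ j := by rintro rfl; omega
  have hii : i ≠ i' := by rintro rfl; omega
  have hm : IsMove (fun _ : Fin 1 => T) (mv i i' b j) :=
    mv_isMove T i i' b j (Or.inl ⟨hT b, hT j⟩)
  refine ⟨mv i i' b j, ⟨⟨i, i', b, j, hii, hbj, rfl⟩, hm⟩, ⟨?_, ?_⟩, ?_⟩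
  · have h1 := hx.1 (i, b)
    have h2 := hx.1 (i', j)
    simp only [Pi.sub_apply] at hb hn
    exact sub_nonneg_mv y hy.1 i i' b j hii (by omega) (by omega)
  · rw [configMap_sub, hm, hy.2, sub_zero]
  · have := l1_mv (x - y) i i' b j hii hbj (-1) (-1) 1 (-1) (abs_up_neg _ hb) (abs_up_neg _ hn)
      (abs_dn_le _) (abs_dn_pos _ hp)
    omega

lemma reduce_one (F B : Set (Table R C)) (x y : Table R C)
    (h : ∃ D ∈ B, y - D ∈ F ∧ l1 (x - y + D) < l1 (x - y)) : CanReduce F B x y := by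
  obtain ⟨D, hD, h1, h2⟩ := h
  refine ⟨0, 1, by omega, fun s => s.elim0, fun _ => D, fun s => s.elim0, fun _ => hD,
    fun s => s.elim0, ?_, by simpa using h2⟩
  intro u
  have : (Iic u : Finset (Fin 1)) = {0} := by ext s; simp [Subsingleton.elim s u, Subsingleton.elim u 0]
  rw [this, sum_singleton]; exact h1

lemma reduce_two (F B : Set (Table R C)) (x y E : Table R C) (hE : E ∈ B) (hxE : x + E ∈ F)
    (hl : l1 (x - y + E) ≤ l1 (x - y))
    (h : ∃ D ∈ B, y - D ∈ F ∧ l1 (x + E - y + D) < l1 (x + E - y)) : CanReduce F B x y := by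
  obtain ⟨D, hD, h1, h2⟩ := h
  have hi : ∀ u : Fin 1, (Iic u : Finset (Fin 1)) = {0} := by
    intro u; ext s; simp [Subsingleton.elim s u, Subsingleton.elim u 0]
  have he : x + E - y = x - y + E := by abel
  rw [he] at h2
  refine ⟨1, 1, by omega, fun _ => E, fun _ => D, fun _ => hE, fun _ => hD, ?_, ?_, ?_⟩
  · intro u; rw [hi, sum_singleton]; exact hxE
  · intro u; rw [hi, sum_singleton]; exact h1
  · simp only [univ_unique, sum_singleton]; omega

lemma core (T : Finset (Fin R × Fin C)) (t) (x y : Table R C)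
    (hx : x ∈ Fiber (fun _ : Fin 1 => T) t) (hy : y ∈ Fiber (fun _ : Fin 1 => T) t)
    (i i' : Fin R) (j j' : Fin C) (hr : ∀ b, (i, b) ∈ T ↔ (i', b) ∈ T)
    (hc : ∀ a, (a, j) ∈ T ↔ (a, j') ∈ T)
    (hp : 0 < (x - y) (i, j)) (hn : (x - y) (i', j') < 0) :
    CanReduce (Fiber (fun _ : Fin 1 => T) t) (mvs T) x y := by
  rcases lt_trichotomy ((x - y) (i', j)) 0 with h | h | h
  · exact reduce_one _ _ _ _ (same_col T t x y hx hy i i' j hr hp h)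
  · obtain ⟨b, hb⟩ := exists_pos' _ (row_zero T t x y hx hy i') j' hn
    have hbj : b ≠ j := by rintro rfl; omega
    have hbj' : b ≠ j' := by rintro rfl; omega
    have hjj' : j ≠ j' := by rintro rfl; omega
    have hii : i ≠ i' := by rintro rfl; omega
    have hm : IsMove (fun _ : Fin 1 => T) (mv i i' b j) :=
      mv_isMove T i i' b j (Or.inl ⟨hr b, hr j⟩)
    have hF : x + mv i i' b j ∈ Fiber (fun _ : Fin 1 => T) t := by
      refine ⟨?_, ?_⟩
      · have h1 := hy.1 (i', b)
        have h2 := hy.1 (i, j)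
        simp only [Pi.sub_apply] at hb hp
        exact add_nonneg_mv x hx.1 i i' b j hii (by omega) (by omega)
      · rw [configMap_add, hm, hx.2, add_zero]
    refine reduce_two _ _ x y (mv i i' b j) ⟨⟨i, i', b, j, hii, hbj, rfl⟩, hm⟩ hF ?_ ?_
    · have := l1_mv (x - y) i i' b j hii hbj 1 1 (-1) (-1) (abs_up_le _) (abs_up_le _)
        (abs_dn_pos _ hb) (abs_dn_pos _ hp)
      omega
    · refine same_row T t _ y hF hy i' j j' hc ?_ ?_
      · simp only [Pi.sub_apply] at h
        simp [mv, e, hii.symm, hbj.symm]; omega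
      · simp only [Pi.sub_apply] at hn
        simp [mv, e, hii.symm, hbj'.symm, hjj'.symm]; omega
  · exact reduce_one _ _ _ _ (same_row T t x y hx hy i' j j' hc h hn)

end core

lemma mem_block {R C : ℕ} (rr cc : ℕ → ℕ) (k l : ℕ) (p : Fin R × Fin C) :
    p ∈ block rr cc k l ↔ rr k ≤ p.1.1 + 1 ∧ p.1.1 + 1 < rr (k+1) ∧ cc l ≤ p.2.1 + 1 ∧
      p.2.1 + 1 < cc (l+1) := by
  simp [block]

lemma mem_Sdiag {R C N : ℕ} (rr cc : ℕ → ℕ) (p : Fin R × Fin C) :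
    p ∈ Sdiag N rr cc ↔ ∃ m, (1 ≤ m ∧ m ≤ N) ∧ rr m ≤ p.1.1 + 1 ∧ p.1.1 + 1 < rr (m+1) ∧
      cc m ≤ p.2.1 + 1 ∧ p.2.1 + 1 < cc (m+1) := by
  simp [Sdiag, mem_block]

/-- if some block `I_{kl}` contains a positive cell and a negative cell
of `z = x − y`, then `‖z‖₁` can be reduced by moves of Type I in `M_S`. -/
theorem blockDiagonal_reduce_typeI (R C N : ℕ) (hN : 3 ≤ N)
    (rr cc : ℕ → ℕ) (hr1 : rr 1 = 1) (hc1 : cc 1 = 1)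
    (hrmono : ∀ n, 1 ≤ n → n ≤ N → rr n < rr (n + 1))
    (hcmono : ∀ n, 1 ≤ n → n ≤ N → cc n < cc (n + 1))
    (hrtop : rr (N + 1) = R + 1) (hctop : cc (N + 1) = C + 1)
    (t : (Fin R → ℤ) × (Fin C → ℤ) × (Fin 1 → ℤ))
    (x y : Table R C)
    (hx : x ∈ Fiber (fun _ : Fin 1 => Sdiag (R := R) (C := C) N rr cc) t)
    (hy : y ∈ Fiber (fun _ : Fin 1 => Sdiag (R := R) (C := C) N rr cc) t)
    (hxy : x ≠ y)
    (k l : ℕ) (hk1 : 1 ≤ k) (hkN : k ≤ N) (hl1 : 1 ≤ l) (hlN : l ≤ N)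
    (p q : Fin R × Fin C)
    (hp : p ∈ block (R := R) (C := C) rr cc k l)
    (hq : q ∈ block (R := R) (C := C) rr cc k l)
    (hppos : 0 < x p - y p) (hqneg : x q - y q < 0) :
    CanReduce (Fiber (fun _ : Fin 1 => Sdiag (R := R) (C := C) N rr cc) t)
      {z | IsBasicMove z ∧ IsMove (fun _ : Fin 1 => Sdiag (R := R) (C := C) N rr cc) z}
      x y := by
  rw [mem_block] at hp hq
  obtain ⟨p1, p2, p3, p4⟩ := hp
  obtain ⟨q1, q2, q3, q4⟩ := hq
  refine core (Sdiag N rr cc) t x y hx hy p.1 q.1 p.2 q.2 ?_ ?_ hppos hqneg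
  · intro b
    rw [mem_Sdiag, mem_Sdiag]
    constructor
    · rintro ⟨m, ⟨h1, h2⟩, h3, h4, h5⟩
      obtain rfl := blk_unique N rr hrmono m k _ h1 h2 hk1 hkN h3 h4 p1 p2
      exact ⟨m, ⟨h1, h2⟩, q1, q2, h5⟩
    · rintro ⟨m, ⟨h1, h2⟩, h3, h4, h5⟩
      obtain rfl := blk_unique N rr hrmono m k _ h1 h2 hk1 hkN h3 h4 q1 q2
      exact ⟨m, ⟨h1, h2⟩, p1, p2, h5⟩
  · intro a
    rw [mem_Sdiag, mem_Sdiag]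
    constructor
    · rintro ⟨m, ⟨h1, h2⟩, h3, h4, h5, h6⟩
      obtain rfl := blk_unique N cc hcmono m l _ h1 h2 hl1 hlN h5 h6 p3 p4
      exact ⟨m, ⟨h1, h2⟩, h3, h4, q3, q4⟩
    · rintro ⟨m, ⟨h1, h2⟩, h3, h4, h5, h6⟩
      obtain rfl := blk_unique N cc hcmono m l _ h1 h2 hl1 hlN h5 h6 q3 q4
      exact ⟨m, ⟨h1, h2⟩, h3, h4, p3, p4⟩

end Paper
end

section
/- Let N ≥ 3 and let S = I_{11} ∪ ⋯ ∪ I_{NN}. Suppose x ≠ y lie in the same fiber F_t of A_S, put z = x − y, and assume that for every block I_{kl} either z(I_{kl}) ≥ 0 or z(I_{kl}) ≤ 0 holds. Suppose z_{ij} > 0 for some cell (i,j) ∈ I_{kk}, and there exists an index l with z(I_{ll}) < 0 such that either (there exists i′ with r_l ≤ i′ < r_{l+1}, z_{i′j} < 0, and z(I_{kl}) > 0) or (there exists j′ with c_l ≤ j′ < c_{l+1}, z_{ij′} < 0, and z(I_{lk}) > 0). Then ‖z‖_1 can be reduced by a move of Type III or Type IV belonging to M_S. -/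
open Finset

namespace Paper

theorem idx_exists (f : ℕ → ℕ) (N M v : ℕ) (h1 : f 1 = 1) (ht : f (N + 1) = M + 1) (hv : v < M) :
    ∃ m, 1 ≤ m ∧ m ≤ N ∧ f m ≤ v + 1 ∧ v + 1 < f (m + 1) := by
  by_contra hcon
  push Not at hcon
  have : ∀ n, n ≤ N → f (n + 1) ≤ v + 1 := by
    intro n
    induction n with
    | zero => intro _; simp [h1]
    | succ n ih => intro hn; exact hcon (n + 1) (by omega) hn (ih (by omega))
  have := this N le_rfl
  omega

theorem idx_mono (f : ℕ → ℕ) (N : ℕ) (hm : ∀ n, 1 ≤ n → n ≤ N → f n < f (n + 1)) (a b : ℕ)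
    (ha : 1 ≤ a) (hab : a ≤ b) (hb : b ≤ N + 1) : f a ≤ f b := by
  induction b, hab using Nat.le_induction with
  | base => exact le_rfl
  | succ n hn ih => exact (ih (by omega)).trans (hm n (by omega) (by omega)).le

theorem idx_unique (f : ℕ → ℕ) (N : ℕ) (hm : ∀ n, 1 ≤ n → n ≤ N → f n < f (n + 1)) (a b v : ℕ)
    (ha : 1 ≤ a) (haN : a ≤ N) (hb : 1 ≤ b) (hbN : b ≤ N)
    (h1 : f a ≤ v) (h2 : v < f (a + 1)) (h3 : f b ≤ v) (h4 : v < f (b + 1)) : a = b := by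
  rcases lt_trichotomy a b with h | h | h
  · have := idx_mono f N hm (a + 1) b (by omega) h (by omega)
    omega
  · exact h
  · have := idx_mono f N hm (b + 1) a (by omega) h (by omega)
    omega

theorem exists_pos_of_sum {C : ℕ} (g : Fin C → ℤ) (h : ∑ j, g j = 0) (j : Fin C) (hj : g j < 0) :
    ∃ j', 0 < g j' := by
  by_contra hcon
  push Not at hcon
  have := Finset.sum_lt_sum (s := Finset.univ) (f := g) (g := fun _ => 0)
    (fun i _ => hcon i) ⟨j, Finset.mem_univ _, hj⟩
  simp at this
  omega

theorem exists_two_pos {C : ℕ} (g : Fin C → ℤ) (h : ∑ j, g j = 0) (j d : Fin C) (hj : g j < 0)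
    (hd : g d < 0) (hjd : j ≠ d) :
    ∃ j₃ j₄, 0 < g j₃ ∧ 0 < g j₄ ∧ (j₃ = j₄ → 2 ≤ g j₃) := by
  obtain ⟨q, hq⟩ := exists_pos_of_sum g h j hj
  by_contra hcon
  push Not at hcon
  have h1 : ∀ v, v ≠ q → g v ≤ 0 := by
    intro v hv
    by_contra h'
    have := (hcon v q (by omega) hq).1
    exact hv this
  have h2 : g q < 2 := (hcon q q hq hq).2
  have h3 : ∑ v, g v ≤ ∑ v, ((if v = q then 1 else 0) - (if v = j then 1 else 0)
      - (if v = d then 1 else 0) : ℤ) := by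
    apply Finset.sum_le_sum
    intro v _
    by_cases a1 : v = q
    · subst a1
      have : v ≠ j := by rintro rfl; omega
      have : v ≠ d := by rintro rfl; omega
      simp [*]; omega
    · have := h1 v a1
      by_cases a2 : v = j
      · subst a2; simp [a1, hjd]; omega
      · by_cases a3 : v = d
        · subst a3; simp [a1, a2]; omega
        · simp [a1, a2, a3, this]
  simp [Finset.sum_sub_distrib] at h3
  omega

theorem sum_e_row {R C : ℕ} (a : Fin R × Fin C) (i : Fin R) :
    ∑ j, e a (i, j) = if i = a.1 then 1 else 0 := by
  obtain ⟨a, b⟩ := a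
  by_cases h : i = a <;> simp [e, h]

theorem sum_e_col {R C : ℕ} (a : Fin R × Fin C) (j : Fin C) :
    ∑ i, e a (i, j) = if j = a.2 then 1 else 0 := by
  obtain ⟨a, b⟩ := a
  by_cases h : j = b <;> simp [e, h]

theorem sum_e_set {R C : ℕ} (a : Fin R × Fin C) (S : Finset (Fin R × Fin C)) :
    ∑ p ∈ S, e a p = if a ∈ S then 1 else 0 := by
  simp [e]

theorem core_s12 (R C N : ℕ)
    (rr cc : ℕ → ℕ)
    (hrmono : ∀ n, 1 ≤ n → n ≤ N → rr n < rr (n + 1))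
    (hcmono : ∀ n, 1 ≤ n → n ≤ N → cc n < cc (n + 1))
    (z : Table R C)
    (hrow : ∀ i, ∑ j, z (i, j) = 0)
    (hsign : ∀ k l, 1 ≤ k → k ≤ N → 1 ≤ l → l ≤ N →
      (∀ p ∈ block (R := R) (C := C) rr cc k l, 0 ≤ z p) ∨
      (∀ p ∈ block (R := R) (C := C) rr cc k l, z p ≤ 0))
    (k : ℕ) (hk1 : 1 ≤ k) (hkN : k ≤ N)
    (i : Fin R) (j : Fin C)
    (hij : (i, j) ∈ block (R := R) (C := C) rr cc k k)
    (hijpos : 0 < z (i, j))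
    (l : ℕ) (hl1 : 1 ≤ l) (hlN : l ≤ N)
    (hll : ∃ p ∈ block (R := R) (C := C) rr cc l l, z p < 0)
    (hcase :
      ((∃ i' : Fin R, rr l ≤ i'.1 + 1 ∧ i'.1 + 1 < rr (l + 1) ∧
          z (i', j) < 0) ∧
        (∃ p ∈ block (R := R) (C := C) rr cc k l, 0 < z p))) :
    ∃ B : Table R C, IsTypeIVrow N N rr cc B ∧
      (∀ i, ∑ j, B (i, j) = 0) ∧ (∀ j, ∑ i, B (i, j) = 0) ∧
      (∑ p ∈ Sdiag N rr cc, B p = 0) ∧ (∀ p, B p < 0 → 0 ≤ z p + B p) ∧ l1 (z + B) < l1 z := by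
  obtain ⟨⟨c, d⟩, hcd, hcdneg⟩ := hll
  obtain ⟨⟨i', hi1, hi2, hi'neg⟩, ⟨a, b⟩, hab, habpos⟩ := hcase
  have hkl : k ≠ l := by
    rintro rfl
    rcases hsign k k hk1 hkN hk1 hkN with h | h
    · have := h _ hcd; omega
    · have := h _ hij; omega
  simp only [block, Finset.mem_filter, Finset.mem_univ, true_and] at hij hcd hab
  have hblk : ∀ (p : Fin R × Fin C) m n, p ∈ block (R := R) (C := C) rr cc m n ↔
      rr m ≤ p.1.1 + 1 ∧ p.1.1 + 1 < rr (m+1) ∧ cc n ≤ p.2.1 + 1 ∧ p.2.1 + 1 < cc (n+1) := by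
    intro p m n; simp [block]
  have hllneg : ∀ p ∈ block (R := R) (C := C) rr cc l l, z p ≤ 0 := by
    rcases hsign l l hl1 hlN hl1 hlN with h | h
    · have := h (c, d) ((hblk _ _ _).2 hcd); omega
    · exact h
  have hlkneg : ∀ p ∈ block (R := R) (C := C) rr cc l k, z p ≤ 0 := by
    rcases hsign l k hl1 hlN hk1 hkN with h | h
    · have := h (i', j) ((hblk _ _ _).2 ⟨hi1, hi2, hij.2.2⟩); omega
    · exact h
  have hdj : j ≠ d := by
    rintro rfl
    exact hkl (idx_unique cc N hcmono k l (j.1 + 1) hk1 hkN hl1 hlN hij.2.2.1 hij.2.2.2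
      hcd.2.2.1 hcd.2.2.2)
  obtain ⟨j₃, j₄, h3, h4, h34⟩ : ∃ j₃ j₄, 0 < z (c, j₃) ∧ 0 < z (i', j₄) ∧
      (c = i' → j₃ = j₄ → 2 ≤ z (c, j₃)) := by
    by_cases hci : c = i'
    · subst hci
      obtain ⟨j₃, j₄, h3, h4, h34⟩ := exists_two_pos (fun v => z (c, v)) (hrow c) j d hi'neg hcdneg hdj
      exact ⟨j₃, j₄, h3, h4, fun _ => h34⟩
    · obtain ⟨j₃, h3⟩ := exists_pos_of_sum (fun v => z (c, v)) (hrow c) d hcdneg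
      obtain ⟨j₄, h4⟩ := exists_pos_of_sum (fun v => z (i', v)) (hrow i') j hi'neg
      exact ⟨j₃, j₄, h3, h4, fun h => absurd h hci⟩
  -- columns outside k, l
  have hout : ∀ (r : Fin R) (v : Fin C), rr l ≤ r.1 + 1 → r.1 + 1 < rr (l + 1) → 0 < z (r, v) →
      ¬ (cc k ≤ v.1 + 1 ∧ v.1 + 1 < cc (k + 1)) ∧ ¬ (cc l ≤ v.1 + 1 ∧ v.1 + 1 < cc (l + 1)) := by
    intro r v hr hr' hz
    constructor
    · intro h
      have := hlkneg (r, v) ((hblk _ _ _).2 ⟨hr, hr', h⟩); omega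
    · intro h
      have := hllneg (r, v) ((hblk _ _ _).2 ⟨hr, hr', h⟩); omega
  have ho3 := hout c j₃ hcd.1 hcd.2.1 h3
  have ho4 := hout i' j₄ hi1 hi2 h4
  have hS : ∀ (r : Fin R) (v : Fin C) m, 1 ≤ m → m ≤ N → rr m ≤ r.1 + 1 → r.1 + 1 < rr (m + 1) →
      ((r, v) ∈ Sdiag N rr cc ↔ (cc m ≤ v.1 + 1 ∧ v.1 + 1 < cc (m + 1))) := by
    intro r v m hm hmN h1 h2
    simp only [Sdiag, Finset.mem_biUnion, Finset.mem_Icc, hblk]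
    constructor
    · rintro ⟨m', ⟨h3, h4⟩, h5, h6, h7, h8⟩
      have := idx_unique rr N hrmono m m' (r.1 + 1) hm hmN h3 h4 h1 h2 h5 h6
      subst this
      exact ⟨h7, h8⟩
    · intro h
      exact ⟨m, ⟨hm, hmN⟩, h1, h2, h⟩
  have hcol : ∀ v : Fin C, (cc k ≤ v.1 + 1 ∧ v.1 + 1 < cc (k + 1)) →
      ¬ (cc l ≤ v.1 + 1 ∧ v.1 + 1 < cc (l + 1)) := by
    intro v h1 h2
    exact hkl (idx_unique cc N hcmono k l (v.1 + 1) hk1 hkN hl1 hlN h1.1 h1.2 h2.1 h2.2)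
  have s1 : (c, b) ∈ Sdiag N rr cc := (hS c b l hl1 hlN hcd.1 hcd.2.1).2 hab.2.2
  have s2 : (i', j) ∉ Sdiag N rr cc := fun h =>
    hcol j hij.2.2 ((hS i' j l hl1 hlN hi1 hi2).1 h)
  have s3 : (i, j₃) ∉ Sdiag N rr cc := fun h =>
    ho3.1 ((hS i j₃ k hk1 hkN hij.1 hij.2.1).1 h)
  have s4 : (a, j₄) ∉ Sdiag N rr cc := fun h =>
    ho4.1 ((hS a j₄ k hk1 hkN hab.1 hab.2.1).1 h)
  have s5 : (c, j₃) ∉ Sdiag N rr cc := fun h =>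
    ho3.2 ((hS c j₃ l hl1 hlN hcd.1 hcd.2.1).1 h)
  have s6 : (i', j₄) ∉ Sdiag N rr cc := fun h =>
    ho4.2 ((hS i' j₄ l hl1 hlN hi1 hi2).1 h)
  have s7 : (i, j) ∈ Sdiag N rr cc := (hS i j k hk1 hkN hij.1 hij.2.1).2 hij.2.2
  have s8 : (a, b) ∉ Sdiag N rr cc := fun h =>
    hcol b ((hS a b k hk1 hkN hab.1 hab.2.1).1 h) hab.2.2
  -- minus part
  have hrne : ∀ r r' : Fin R, rr k ≤ r.1 + 1 → r.1 + 1 < rr (k + 1) → rr l ≤ r'.1 + 1 →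
      r'.1 + 1 < rr (l + 1) → r ≠ r' := by
    rintro r _ h1 h2 h3 h4 rfl
    exact hkl (idx_unique rr N hrmono k l (r.1 + 1) hk1 hkN hl1 hlN h1 h2 h3 h4)
  have n1 : i ≠ c := hrne i c hij.1 hij.2.1 hcd.1 hcd.2.1
  have n2 : i ≠ i' := hrne i i' hij.1 hij.2.1 hi1 hi2
  have n3 : a ≠ c := hrne a c hab.1 hab.2.1 hcd.1 hcd.2.1
  have n4 : a ≠ i' := hrne a i' hab.1 hab.2.1 hi1 hi2
  have n5 : j ≠ b := by rintro rfl; exact hcol _ hij.2.2 hab.2.2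
  have hm : ∀ p, (e (c, j₃) p + e (i', j₄) p + e (i, j) p + e (a, b) p = 0) ∨
      (0 < e (c, j₃) p + e (i', j₄) p + e (i, j) p + e (a, b) p ∧
        e (c, j₃) p + e (i', j₄) p + e (i, j) p + e (a, b) p ≤ z p) := by
    rintro ⟨u, v⟩
    simp only [e, Prod.mk.injEq]
    by_cases q1 : u = i ∧ v = j
    · obtain ⟨rfl, rfl⟩ := q1
      simp [n1, n2, n5]; omega
    by_cases q2 : u = a ∧ v = b
    · obtain ⟨rfl, rfl⟩ := q2
      simp [n3, n4, n5.symm]; omega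
    by_cases q3 : u = c ∧ v = j₃
    · obtain ⟨rfl, rfl⟩ := q3
      by_cases q4 : u = i' ∧ v = j₄
      · have := h34 q4.1 q4.2
        simp [n1.symm, n3.symm, q4.1, q4.2, n2.symm, n4.symm]
        rw [q4.1, q4.2] at this; omega
      · simp only [q1, q2, q4]; simp; omega
    by_cases q4 : u = i' ∧ v = j₄
    · simp only [q1, q2, q3]; simp [q4.1, q4.2]; omega
    · simp [q1, q2, q3, q4]
  have e0 : ∀ p q : Fin R × Fin C, e p q = 0 ∨ (e p q = 1 ∧ q = p) := by
    intro p q; unfold e; split_ifs with h <;> simp [h]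
  refine ⟨e (c, b) + e (i', j) + e (i, j₃) + e (a, j₄) - e (c, j₃) - e (i', j₄) - e (i, j)
      - e (a, b), ⟨c, i', i, a, b, j, j₃, j₄, rfl, ⟨l, k, hl1, hlN, hk1, hkN, hkl.symm, ?_, ?_⟩, ?_,
        ⟨l, hl1, hlN, hcd.1, hcd.2.1, hi1, hi2⟩, ⟨k, hk1, hkN, hij.1, hij.2.1, hab.1, hab.2.1⟩⟩,
        ?_, ?_, ?_, ?_, ?_⟩
  · exact (hblk _ _ _).2 ⟨hcd.1, hcd.2.1, hab.2.2⟩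
  · exact (hblk _ _ _).2 hij
  · simp [s2, s3, s4, s5, s6, s8]
  · intro r
    simp only [Pi.add_apply, Pi.sub_apply, Finset.sum_add_distrib, Finset.sum_sub_distrib, sum_e_row]
    ring
  · intro r
    simp only [Pi.add_apply, Pi.sub_apply, Finset.sum_add_distrib, Finset.sum_sub_distrib, sum_e_col]
    ring
  · simp only [Pi.add_apply, Pi.sub_apply, Finset.sum_add_distrib, Finset.sum_sub_distrib, sum_e_set]
    simp [s1, s2, s3, s4, s5, s6, s7, s8]
  · intro p
    simp only [Pi.add_apply, Pi.sub_apply]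
    have := hm p
    have := e0 (c, b) p
    have := e0 (i', j) p
    have := e0 (i, j₃) p
    have := e0 (a, j₄) p
    omega
  · have key : ∀ p, |(z + (e (c, b) + e (i', j) + e (i, j₃) + e (a, j₄) - e (c, j₃) - e (i', j₄)
        - e (i, j) - e (a, b))) p| ≤ |z p| + e (c, b) p + e (i, j₃) p + e (a, j₄) p
        - e (c, j₃) p - e (i', j₄) p - e (i, j) p - e (a, b) p - e (i', j) p := by
      intro p
      simp only [Pi.add_apply, Pi.sub_apply]
      have := hm p
      have := e0 (c, b) p
      have := e0 (i, j₃) p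
      have := e0 (a, j₄) p
      rcases e0 (i', j) p with h | ⟨h, rfl⟩
      · rw [h, abs_le]
        rcases abs_cases (z p) with ⟨h', _⟩ | ⟨h', _⟩ <;> rw [h'] <;> omega
      · rw [h, abs_le, abs_of_neg hi'neg]
        omega
    have tot : ∀ p : Fin R × Fin C, ∑ q, e p q = 1 := by
      intro p; simp [e]
    calc l1 (z + _) ≤ _ := Finset.sum_le_sum (fun p _ => key p)
      _ = l1 z - 2 := by
        simp only [Finset.sum_add_distrib, Finset.sum_sub_distrib, tot, l1]; ring
      _ < l1 z := by omega

/-- under block-wise sign constancy, if `z_{ij} > 0` for some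
`(i,j) ∈ I_{kk}` and there is an `l` with `z(I_{ll}) < 0` such that either
(`z_{i'j} < 0` for some `i'` in the `l`-th row block and `z(I_{kl}) > 0`) or
(`z_{ij'} < 0` for some `j'` in the `l`-th column block and `z(I_{lk}) > 0`), then
`‖z‖₁` can be reduced by a move of Type III or IV in `M_S`. -/
theorem blockDiagonal_reduce_typeIII_IV (R C N : ℕ) (hN : 3 ≤ N)
    (rr cc : ℕ → ℕ) (hr1 : rr 1 = 1) (hc1 : cc 1 = 1)
    (hrmono : ∀ n, 1 ≤ n → n ≤ N → rr n < rr (n + 1))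
    (hcmono : ∀ n, 1 ≤ n → n ≤ N → cc n < cc (n + 1))
    (hrtop : rr (N + 1) = R + 1) (hctop : cc (N + 1) = C + 1)
    (t : (Fin R → ℤ) × (Fin C → ℤ) × (Fin 1 → ℤ))
    (x y : Table R C)
    (hx : x ∈ Fiber (fun _ : Fin 1 => Sdiag (R := R) (C := C) N rr cc) t)
    (hy : y ∈ Fiber (fun _ : Fin 1 => Sdiag (R := R) (C := C) N rr cc) t)
    (hxy : x ≠ y)
    (hsign : ∀ k l, 1 ≤ k → k ≤ N → 1 ≤ l → l ≤ N →
      (∀ p ∈ block (R := R) (C := C) rr cc k l, 0 ≤ x p - y p) ∨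
      (∀ p ∈ block (R := R) (C := C) rr cc k l, x p - y p ≤ 0))
    (k : ℕ) (hk1 : 1 ≤ k) (hkN : k ≤ N)
    (i : Fin R) (j : Fin C)
    (hij : (i, j) ∈ block (R := R) (C := C) rr cc k k)
    (hijpos : 0 < x (i, j) - y (i, j))
    (l : ℕ) (hl1 : 1 ≤ l) (hlN : l ≤ N)
    (hll : ∃ p ∈ block (R := R) (C := C) rr cc l l, x p - y p < 0)
    (hcase :
      ((∃ i' : Fin R, rr l ≤ i'.1 + 1 ∧ i'.1 + 1 < rr (l + 1) ∧
          x (i', j) - y (i', j) < 0) ∧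
        (∃ p ∈ block (R := R) (C := C) rr cc k l, 0 < x p - y p)) ∨
      ((∃ j' : Fin C, cc l ≤ j'.1 + 1 ∧ j'.1 + 1 < cc (l + 1) ∧
          x (i, j') - y (i, j') < 0) ∧
        (∃ p ∈ block (R := R) (C := C) rr cc l k, 0 < x p - y p))) :
    CanReduce (Fiber (fun _ : Fin 1 => Sdiag (R := R) (C := C) N rr cc) t)
      {z | (IsTypeIII N N rr cc z ∨ IsTypeIV N N rr cc z) ∧
        IsMove (fun _ : Fin 1 => Sdiag (R := R) (C := C) N rr cc) z}
      x y := by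
  have hx' := hx
  have hy' := hy
  obtain ⟨hx0, hxt⟩ := hx'
  obtain ⟨hy0, hyt⟩ := hy'
  have heq : configMap (fun _ : Fin 1 => Sdiag (R := R) (C := C) N rr cc) x
      = configMap (fun _ : Fin 1 => Sdiag (R := R) (C := C) N rr cc) y := hxt.trans hyt.symm
  have hrow : ∀ i, ∑ j, (x - y) (i, j) = 0 := by
    intro i
    have := congrFun (congrArg Prod.fst heq) i
    simp only [configMap] at this
    simp [Finset.sum_sub_distrib, this]
  have hcol : ∀ j, ∑ i, (x - y) (i, j) = 0 := by
    intro i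
    have := congrFun (congrArg (fun q => q.2.1) heq) i
    simp only [configMap] at this
    simp [Finset.sum_sub_distrib, this]
  suffices h : ∃ B : Table R C, IsTypeIV N N rr cc B ∧
      (∀ i, ∑ j, B (i, j) = 0) ∧ (∀ j, ∑ i, B (i, j) = 0) ∧
      (∑ p ∈ Sdiag N rr cc, B p = 0) ∧ (∀ p, B p < 0 → 0 ≤ (x - y) p + B p) ∧
      l1 (x - y + B) < l1 (x - y) by
    obtain ⟨B, hB4, hB1, hB2, hB3, hBp, hBl⟩ := h
    refine ⟨1, 0, by omega, fun _ => B, fun _ => 0, ?_, fun s => s.elim0, ?_, fun u => u.elim0, ?_⟩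
    · intro _
      refine ⟨Or.inr hB4, ?_⟩
      simp only [IsMove, configMap, hB1, hB2, hB3]
      rfl
    · intro u
      have : ∑ s ∈ Finset.Iic u, B = B := by
        have : Finset.Iic u = {u} := by ext s; simp [Subsingleton.elim s u]
        rw [this]; simp
      simp only [this]
      refine ⟨fun p => ?_, ?_⟩
      · have h1 := hBp p
        have h2 := hx0 p
        have h3 := hy0 p
        simp only [Pi.add_apply, Pi.sub_apply] at *
        by_cases h : B p < 0
        · have := h1 h; omega
        · omega
      · rw [← hxt]
        simp only [configMap, Pi.add_apply, Finset.sum_add_distrib, hB1, hB2, hB3, add_zero]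
    · simpa using hBl
  rcases hcase with hcase | hcase
  · obtain ⟨B, h4, h⟩ := core_s12 R C N rr cc hrmono hcmono (x - y) hrow hsign k hk1 hkN i j hij hijpos
      l hl1 hlN hll hcase
    exact ⟨B, Or.inl h4, h⟩
  · have hb : ∀ (p : Fin R × Fin C) m n, p ∈ block (R := R) (C := C) rr cc m n ↔
        p.swap ∈ block (R := C) (C := R) cc rr n m := by
      intro p m n
      simp only [block, Finset.mem_filter, Finset.mem_univ, true_and, Prod.fst_swap, Prod.snd_swap]
      tauto
    have hb' : ∀ (p : Fin C × Fin R) m n, p ∈ block (R := C) (C := R) cc rr m n →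
        p.swap ∈ block (R := R) (C := C) rr cc n m := by
      intro p m n h
      rw [hb]; simpa using h
    have hsw : ∀ w : Table R C, l1 (R := C) (C := R) (fun p => w p.swap) = l1 w := by
      intro w
      exact Equiv.sum_comp (Equiv.prodComm (Fin C) (Fin R)) (fun p => |w p|)
    obtain ⟨⟨j', hj'⟩, p₀, hp₀, hp₀'⟩ := hcase
    obtain ⟨p₁, hp₁, hp₁'⟩ := hll
    obtain ⟨B, h4, h1, h2, h3, hp, hl⟩ := core_s12 C R N cc rr hcmono hrmono
      (fun p => (x - y) p.swap) hcol
      (fun m n a1 a2 a3 a4 => (hsign n m a3 a4 a1 a2).imp (fun h p hp => h _ (hb' _ _ _ hp))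
        (fun h p hp => h _ (hb' _ _ _ hp))) k hk1 hkN j i ((hb _ _ _).1 hij) hijpos
      l hl1 hlN ⟨p₁.swap, (hb _ _ _).1 hp₁, by simpa using hp₁'⟩
      ⟨⟨j', hj'⟩, p₀.swap, (hb _ _ _).1 hp₀, by simpa using hp₀'⟩
    refine ⟨fun p => B p.swap, Or.inr h4, h2, h1, ?_, fun p => ?_, ?_⟩
    · rw [← h3]
      refine Finset.sum_equiv (Equiv.prodComm (Fin R) (Fin C)) ?_ (fun _ _ => rfl)
      intro p
      simp only [Sdiag, Finset.mem_biUnion, hb p]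
      rfl
    · simpa using hp p.swap
    · rw [← hsw, ← hsw (x - y)]
      exact hl

end Paper
end
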